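/- In the stochastic SQP setting with safeguarded backtracking line search described in the context, assume q₋₁ ≥ 1 and define κ₉ := ξ⁻¹·( ‖c(x₀)‖₁ − (2 + Γκ_v/2)·ν²·log(q₋₁²) + ν²η²Γ·κ₃/(2q₋₁²) ) and κ₁₀ := 2·(q₋₁ + κ₉/ν) + 8·(4 + Γκ_v)·ξ⁻¹·ν·log(e + (4 + Γκ_v)·ξ⁻¹·ν). Then 𝔼[q_{K−1}] ≤ κ₁₀ and ∑_{k=0}^{K−1} 𝔼[α_k·‖c(x_k)‖₁] ≤ κ₉ + (4 + Γκ_v)·ξ⁻¹·ν²·log(κ₁₀). -/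

import Mathlib

open Matrix MeasureTheory RealInnerProductSpace

/-- The ℓ¹-norm of a vector in `ℝ^m`. -/
noncomputable def l1Norm {k : ℕ} (v : EuclideanSpace ℝ (Fin k)) : ℝ := ∑ i, |v i|

/-- The Jacobian matrix of `c` at `z`, whose rows are the gradients of the components. -/
noncomputable def Jmat {m n : ℕ}
    (gradc : Fin m → EuclideanSpace ℝ (Fin n) → EuclideanSpace ℝ (Fin n))
    (z : EuclideanSpace ℝ (Fin n)) : Matrix (Fin m) (Fin n) ℝ :=
  Matrix.of fun i j => gradc i z j

/-- The previous value of an accumulator sequence: `prevSeq init b k = b (k-1)`,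
with value `init` at `k = 0` (i.e. the "index `-1`" initial value). -/
noncomputable def prevSeq {Ω : Type*} (init : ℝ) (b : ℕ → Ω → ℝ) : ℕ → Ω → ℝ
  | 0 => fun _ => init
  | k + 1 => b k

/-- Second-order Taylor bound for a function with Lipschitz gradient. -/
lemma abs_sub_sub_inner_le_of_lipschitz_gradient {E : Type*} [NormedAddCommGroup E]
    [InnerProductSpace ℝ E] [CompleteSpace E] {f : E → ℝ} {f' : E → E} {G : ℝ}
    (hf : ∀ z, HasGradientAt f (f' z) z) (hLip : ∀ z z', ‖f' z - f' z'‖ ≤ G * ‖z - z'‖)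
    (a d : E) : |f (a + d) - f a - ⟪f' a, d⟫| ≤ G / 2 * ‖d‖ ^ 2 := by
  have hderiv : ∀ t : ℝ, HasDerivAt (fun t : ℝ => f (a + t • d) - f a - t * ⟪f' a, d⟫)
      (⟪f' (a + t • d), d⟫ - ⟪f' a, d⟫) t := by
    intro t
    have h1 : HasDerivAt (fun t : ℝ => a + t • d) d t := by
      simpa using ((hasDerivAt_id t).smul_const d).const_add a
    have h2 := (hf (a + t • d)).hasFDerivAt.comp_hasDerivAt t h1
    have h3 := (hasDerivAt_id t).mul_const ⟪f' a, d⟫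
    have h4 := (h2.sub_const (f a)).sub h3
    rw [one_mul] at h4
    exact h4
  have hbound := image_norm_le_of_norm_deriv_right_le_deriv_boundary
    (f := fun t : ℝ => f (a + t • d) - f a - t * ⟪f' a, d⟫) (a := 0) (b := 1)
    (f' := fun t => ⟪f' (a + t • d), d⟫ - ⟪f' a, d⟫)
    (B := fun t => G / 2 * ‖d‖ ^ 2 * t ^ 2) (B' := fun t => G * ‖d‖ ^ 2 * t)
    (fun t _ => (hderiv t).continuousAt.continuousWithinAt)
    (fun t _ => (hderiv t).hasDerivWithinAt) (by simp)
    (fun t => ((hasDerivAt_pow 2 t).const_mul (G / 2 * ‖d‖ ^ 2)).congr_deriv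
      (by push_cast; ring))
    (fun t ht => by
      rw [← inner_sub_left]
      calc ‖⟪f' (a + t • d) - f' a, d⟫‖ ≤ ‖f' (a + t • d) - f' a‖ * ‖d‖ := norm_inner_le_norm _ _
        _ ≤ G * ‖a + t • d - a‖ * ‖d‖ := by gcongr; exact hLip _ _
        _ = G * ‖d‖ ^ 2 * t := by
          rw [add_sub_cancel_left, norm_smul, Real.norm_of_nonneg ht.1]; ring)
  simpa using hbound (Set.right_mem_Icc.2 zero_le_one)

lemma l1Norm_nonneg {k : ℕ} (v : EuclideanSpace ℝ (Fin k)) : 0 ≤ l1Norm v :=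
  Finset.sum_nonneg fun _ _ => abs_nonneg _

lemma norm_le_l1Norm {k : ℕ} (v : EuclideanSpace ℝ (Fin k)) : ‖v‖ ≤ l1Norm v := by
  rw [EuclideanSpace.norm_eq]
  refine Real.sqrt_le_iff.2 ⟨l1Norm_nonneg v, ?_⟩
  exact Finset.sum_sq_le_sq_sum_of_nonneg fun _ _ => abs_nonneg _

lemma continuous_l1Norm {k : ℕ} : Continuous (l1Norm (k := k)) := by
  unfold l1Norm
  fun_prop

lemma toEuclideanLin_Jmat_apply {m n : ℕ}
    (gradc : Fin m → EuclideanSpace ℝ (Fin n) → EuclideanSpace ℝ (Fin n))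
    (z w : EuclideanSpace ℝ (Fin n)) (i : Fin m) :
    Matrix.toEuclideanLin (Jmat gradc z) w i = ⟪gradc i z, w⟫ := by
  simp [Jmat, Matrix.mulVec, dotProduct, PiLp.inner_apply, mul_comm]

lemma inner_toEuclideanLin_transpose {m n : ℕ} (A : Matrix (Fin m) (Fin n) ℝ)
    (w : EuclideanSpace ℝ (Fin n)) (z : EuclideanSpace ℝ (Fin m)) :
    ⟪w, Matrix.toEuclideanLin Aᵀ z⟫ = ⟪Matrix.toEuclideanLin A w, z⟫ := by
  rw [← Matrix.conjTranspose_eq_transpose_of_trivial, Matrix.toEuclideanLin_conjTranspose_eq_adjoint,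
    LinearMap.adjoint_inner_right]

/-- Descent estimate for the constraint violation along a step `a • d` that solves the linearized
constraints. -/
lemma l1Norm_constraint_step_le {m n : ℕ}
    {c : EuclideanSpace ℝ (Fin n) → EuclideanSpace ℝ (Fin m)}
    {gradc : Fin m → EuclideanSpace ℝ (Fin n) → EuclideanSpace ℝ (Fin n)} {γ : Fin m → ℝ}
    (hc : ∀ i z, HasGradientAt (fun w => c w i) (gradc i z) z)
    (hcLip : ∀ i z z', ‖gradc i z - gradc i z'‖ ≤ γ i * ‖z - z'‖)
    {z d : EuclideanSpace ℝ (Fin n)}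
    (hd : Matrix.toEuclideanLin (Jmat gradc z) d = -c z) (a : ℝ) :
    l1Norm (c (z + a • d))
      ≤ |1 - a| * l1Norm (c z) + (∑ i, γ i) / 2 * (a ^ 2 * ‖d‖ ^ 2) := by
  simp only [l1Norm, Finset.mul_sum, Finset.sum_div, Finset.sum_mul, ← Finset.sum_add_distrib]
  refine Finset.sum_le_sum fun i _ => ?_
  have htaylor := abs_sub_sub_inner_le_of_lipschitz_gradient (hc i) (hcLip i) z (a • d)
  have hi : ⟪gradc i z, d⟫ = -c z i := by
    rw [← toEuclideanLin_Jmat_apply, hd]; rfl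
  rw [inner_smul_right, hi, norm_smul, mul_pow, Real.norm_eq_abs, sq_abs] at htaylor
  calc |c (z + a • d) i|
      = |(1 - a) * c z i + (c (z + a • d) i - c z i - a * -c z i)| := by congr 1; ring
    _ ≤ |(1 - a) * c z i| + |c (z + a • d) i - c z i - a * -c z i| := abs_add_le _ _
    _ ≤ |1 - a| * |c z i| + γ i / 2 * (a ^ 2 * ‖d‖ ^ 2) := by rw [abs_mul]; gcongr

/-- A normal step solving the linearized constraints is controlled by the constraint violation. -/
lemma mul_norm_normal_step_le {m n : ℕ} {A : Matrix (Fin m) (Fin n) ℝ} {s : ℝ}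
    (hs : ∀ z, s * ‖z‖ ≤ ‖Matrix.toEuclideanLin Aᵀ z‖)
    (hs0 : 0 ≤ s)
    {v : EuclideanSpace ℝ (Fin n)} {b : EuclideanSpace ℝ (Fin m)}
    (hv : ∃ z, v = Matrix.toEuclideanLin Aᵀ z) (hb : Matrix.toEuclideanLin A v = -b) :
    s * ‖v‖ ≤ ‖b‖ := by
  obtain ⟨z, hz⟩ := hv
  have hsz := hs z
  rw [← hz] at hsz
  have h1 : ‖v‖ ^ 2 ≤ ‖b‖ * ‖z‖ := by
    rw [← real_inner_self_eq_norm_sq]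
    nth_rewrite 2 [hz]
    rw [inner_toEuclideanLin_transpose, hb]
    simpa using real_inner_le_norm (-b) z
  rcases (norm_nonneg v).eq_or_lt with h | h
  · rw [← h]; simp
  · refine le_of_mul_le_mul_right ?_ h
    nlinarith [norm_nonneg b, mul_le_mul_of_nonneg_left h1 hs0,
      mul_le_mul_of_nonneg_left hsz (norm_nonneg b)]

/-- Solutions of a saddle-point system with homogeneous constraints are controlled by the
right-hand side. -/
lemma mul_norm_saddle_solution_le {m n : ℕ} {A : Matrix (Fin m) (Fin n) ℝ}
    {H : Matrix (Fin n) (Fin n) ℝ} {ζ : ℝ} {w r : EuclideanSpace ℝ (Fin n)}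
    {y : EuclideanSpace ℝ (Fin m)}
    (hpd : ζ * ‖w‖ ^ 2 ≤ ⟪w, Matrix.toEuclideanLin H w⟫)
    (hA : Matrix.toEuclideanLin A w = 0)
    (hsys : Matrix.toEuclideanLin H w + Matrix.toEuclideanLin Aᵀ y = r) :
    ζ * ‖w‖ ≤ ‖r‖ := by
  have h1 : ⟪w, Matrix.toEuclideanLin H w⟫ = ⟪w, r⟫ := by
    rw [← hsys, inner_add_right, inner_toEuclideanLin_transpose, hA, inner_zero_left, add_zero]
  rcases (norm_nonneg w).eq_or_lt with h | h
  · rw [← h]; simp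
  · refine le_of_mul_le_mul_right ?_ h
    nlinarith [real_inner_le_norm w r]

/-- One step of the safeguarded line search: progress in the constraint violation, and growth
of the accumulator `q`. -/
lemma safeguarded_step {Q Q' C C' a U ν ξ G κ b q₀ : ℝ} (hν : 0 < ν) (hξ : ξ ∈ Set.Ioo (0 : ℝ) 1)
    (hG : 0 ≤ G) (hκ : 0 ≤ κ) (hb : 0 ≤ b) (hq₀ : 0 < q₀) (hQ : q₀ ≤ Q) (hC : 0 ≤ C)
    (hU : 0 ≤ U)
    (hcase : (ν / √(Q ^ 2 + C) ≤ a ∧ C' ≤ (1 - ξ * a) * C ∧ Q' = Q) ∨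
      (a = ν / √(Q ^ 2 + C) ∧ Q' = √(Q ^ 2 + C) ∧
        C' ≤ |1 - a| * C + G / 2 * (a ^ 2 * (b * U + κ * C)))) :
    ξ * (a * C) ≤ C - C' + (2 + G * κ / 2) * ν ^ 2 * (Real.log (Q' ^ 2) - Real.log (Q ^ 2))
        + ν ^ 2 * G / (2 * q₀ ^ 2) * (b * U) ∧
      0 ≤ a * C ∧ Q ≤ Q' ∧ Q' ≤ Q + ν⁻¹ * (a * C) ∧ Q' ^ 2 ≤ Q ^ 2 + C := by
  have hQ0 : 0 < Q := hq₀.trans_le hQ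
  have hR : 0 < √(Q ^ 2 + C) := Real.sqrt_pos.2 (by positivity)
  have hR2 : √(Q ^ 2 + C) ^ 2 = Q ^ 2 + C := Real.sq_sqrt (by positivity)
  have hlast : 0 ≤ ν ^ 2 * G / (2 * q₀ ^ 2) * (b * U) := by positivity
  have ha : 0 < a := by
    have : 0 < ν / √(Q ^ 2 + C) := by positivity
    rcases hcase with h | h
    · exact this.trans_le h.1
    · rw [h.1]; exact this
  have haC : 0 ≤ a * C := by positivity
  rcases hcase with ⟨-, hC', rfl⟩ | ⟨ha', hQ', hC'⟩
  · refine ⟨?_, haC, le_rfl, le_add_of_nonneg_right (by positivity), le_add_of_nonneg_right hC⟩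
    simp only [sub_self, mul_zero]
    linarith
  · rw [← hQ'] at ha' hR hR2
    have hQQ' : Q ≤ Q' := by nlinarith
    have haQ : a * Q' = ν := by rw [ha']; field_simp
    have ha2 : a ^ 2 * Q' ^ 2 = ν ^ 2 := by rw [← haQ]; ring
    refine ⟨?_, haC, hQQ', ?_, hR2.le⟩
    · have habs : |1 - a| ≤ 1 - a + 2 * a ^ 2 := abs_le.2 ⟨by nlinarith, by nlinarith⟩
      have hlog : a ^ 2 * C ≤ ν ^ 2 * (Real.log (Q' ^ 2) - Real.log (Q ^ 2)) := by
        have h1 := Real.one_sub_inv_le_log_of_pos (x := Q' ^ 2 / Q ^ 2) (by positivity)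
        rw [Real.log_div (by positivity) (by positivity)] at h1
        calc a ^ 2 * C = ν ^ 2 * (1 - (Q' ^ 2 / Q ^ 2)⁻¹) := by
              rw [← ha2]; field_simp; linarith
          _ ≤ _ := by gcongr
      have ha3 : a ^ 2 ≤ ν ^ 2 / q₀ ^ 2 := by
        rw [le_div_iff₀ (by positivity), ← ha2]
        gcongr
        exact hQ.trans hQQ'
      have h4 : G / 2 * (a ^ 2 * (b * U)) ≤ ν ^ 2 * G / (2 * q₀ ^ 2) * (b * U) := by
        calc G / 2 * (a ^ 2 * (b * U)) ≤ G / 2 * (ν ^ 2 / q₀ ^ 2 * (b * U)) := by gcongr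
          _ = _ := by field_simp
      have h5 : ξ * (a * C) ≤ a * C := mul_le_of_le_one_left haC hξ.2.le
      have h6 := mul_le_mul_of_nonneg_right habs hC
      have h7 := mul_le_mul_of_nonneg_left hlog (show 0 ≤ 2 + G * κ / 2 by positivity)
      linarith
    · have h1 : ν⁻¹ * (a * C) * Q' = C := by rw [← haQ]; field_simp
      refine le_of_mul_le_mul_right ?_ hR
      nlinarith

/-- Summed form of `safeguarded_step`. -/
lemma safeguarded_sum {Q C a U : ℕ → ℝ} {ν ξ G κ b : ℝ} (hν : 0 < ν) (hξ : ξ ∈ Set.Ioo (0 : ℝ) 1)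
    (hG : 0 ≤ G) (hκ : 0 ≤ κ) (hb : 0 ≤ b) (hQ : 0 < Q 0) (hC : ∀ k, 0 ≤ C k)
    (hU : ∀ k, 0 ≤ U k)
    (hcase : ∀ k, (ν / √(Q k ^ 2 + C k) ≤ a k ∧ C (k + 1) ≤ (1 - ξ * a k) * C k ∧
        Q (k + 1) = Q k) ∨
      (a k = ν / √(Q k ^ 2 + C k) ∧ Q (k + 1) = √(Q k ^ 2 + C k) ∧
        C (k + 1) ≤ |1 - a k| * C k + G / 2 * (a k ^ 2 * (b * U k + κ * C k)))) (N : ℕ) :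
    ξ * ∑ k ∈ Finset.range N, a k * C k ≤ C 0 - C N
        + (2 + G * κ / 2) * ν ^ 2 * (Real.log (Q N ^ 2) - Real.log (Q 0 ^ 2))
        + ν ^ 2 * G / (2 * Q 0 ^ 2) * (b * ∑ k ∈ Finset.range N, U k) ∧
      Q 0 ≤ Q N ∧ Q N ≤ Q 0 + ν⁻¹ * ∑ k ∈ Finset.range N, a k * C k ∧
      Q N ^ 2 ≤ Q 0 ^ 2 + ∑ k ∈ Finset.range N, C k := by
  induction N with
  | zero => simp
  | succ N ih =>
    obtain ⟨h1, h2, h3, h4⟩ := ih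
    obtain ⟨k1, -, k3, k4, k5⟩ := safeguarded_step hν hξ hG hκ hb hQ h2 (hC N) (hU N) (hcase N)
    simp only [Finset.sum_range_succ, mul_add]
    exact ⟨by linarith, by linarith, by linarith, by linarith⟩

/-- Solving the implicit inequality `Q ≤ A + B log Q`. -/
lemma le_of_le_add_mul_log {Q A B : ℝ} (hQ : 0 < Q) (hB : 0 < B)
    (h : Q ≤ A + B * Real.log Q) :
    Q ≤ 2 * A + 8 * B * Real.log (Real.exp 1 + B) := by
  have h1 := Real.log_le_sub_one_of_pos (x := Q / (2 * B)) (by positivity)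
  rw [Real.log_div hQ.ne' (by positivity), Real.log_mul two_ne_zero hB.ne'] at h1
  have h2 : B * (Q / (2 * B)) = Q / 2 := by field_simp
  have h3 := mul_le_mul_of_nonneg_left h1 hB.le
  have h4 : Real.log B ≤ Real.log (Real.exp 1 + B) :=
    Real.log_le_log hB (by linarith [Real.exp_pos 1])
  have h5 : 0 ≤ Real.log (Real.exp 1 + B) :=
    Real.log_nonneg (by linarith [Real.add_one_le_exp 1])
  have h6 : Real.log 2 ≤ 1 := Real.log_two_lt_d9.le.trans (by norm_num)
  nlinarith [mul_le_mul_of_nonneg_left h4 hB.le, mul_nonneg hB.le h5,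
    mul_le_mul_of_nonneg_left h6 hB.le]

lemma stronglyMeasurable_toEuclideanLin {Ω : Type*} {mΩ : MeasurableSpace Ω} {m n : ℕ}
    {A : Ω → Matrix (Fin m) (Fin n) ℝ} {w : Ω → EuclideanSpace ℝ (Fin n)}
    (hA : ∀ i j, StronglyMeasurable fun ω => A ω i j) (hw : StronglyMeasurable w) :
    StronglyMeasurable fun ω => Matrix.toEuclideanLin (A ω) (w ω) := by
  refine Measurable.stronglyMeasurable ?_
  refine (WithLp.measurable_toLp 2 (Fin m → ℝ)).comp (measurable_pi_lambda _ fun i => ?_)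
  change Measurable fun ω => ∑ j, A ω i j * w ω j
  refine Finset.measurable_sum _ fun j _ => (hA i j).measurable.mul ?_
  exact ((continuous_apply j).comp (PiLp.continuous_ofLp 2 _)).measurable.comp hw.measurable

lemma norm_toEuclideanLin_transpose_le {n : ℕ} {A : Matrix (Fin n) (Fin n) ℝ} {C : ℝ}
    (hA : ∀ z, ‖Matrix.toEuclideanLin A z‖ ≤ C * ‖z‖) (w : EuclideanSpace ℝ (Fin n)) :
    ‖Matrix.toEuclideanLin Aᵀ w‖ ≤ C * ‖w‖ := by
  have h1 : ‖Matrix.toEuclideanLin Aᵀ w‖ ^ 2 ≤ C * ‖Matrix.toEuclideanLin Aᵀ w‖ * ‖w‖ := by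
    rw [← real_inner_self_eq_norm_sq, inner_toEuclideanLin_transpose]
    exact (real_inner_le_norm _ _).trans (by gcongr; exact hA _)
  rcases (norm_nonneg (Matrix.toEuclideanLin Aᵀ w)).eq_or_lt with h | h
  · rw [← h]
    exact (norm_nonneg _).trans (hA w)
  · refine le_of_mul_le_mul_right ?_ h
    nlinarith

section Stochastic

variable {Ω : Type*} {m0 : MeasurableSpace Ω} {μ : Measure Ω}

lemma MeasureTheory.MemLp.integrable_inner_of_two {E : Type*} [NormedAddCommGroup E]
    [InnerProductSpace ℝ E] {X Y : Ω → E} (hX : MemLp X 2 μ) (hY : MemLp Y 2 μ) :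
    Integrable (fun ω => ⟪X ω, Y ω⟫) μ :=
  (hX.norm.integrable_mul hY.norm).mono' (hX.1.inner hY.1)
    (Filter.Eventually.of_forall fun _ => norm_inner_le_norm _ _)

lemma condExp_inner_of_stronglyMeasurable_left {E : Type*} [NormedAddCommGroup E]
    [InnerProductSpace ℝ E] [CompleteSpace E] {ℱ : MeasurableSpace Ω} {X Y : Ω → E}
    (hX : StronglyMeasurable[ℱ] X) (hXY : Integrable (fun ω => ⟪X ω, Y ω⟫) μ)
    (hY : Integrable Y μ) :
    μ[fun ω => ⟪X ω, Y ω⟫ | ℱ] =ᵐ[μ] fun ω => ⟪X ω, (μ[Y | ℱ]) ω⟫ :=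
  condExp_bilin_of_stronglyMeasurable_left (innerSL ℝ) hX hXY hY

variable [IsProbabilityMeasure μ]

/-- If the right-hand side of a random saddle-point system has zero conditional expectation, then
so has its solution. -/
lemma condExp_saddle_solution_eq_zero {m n : ℕ} {ℱ : MeasurableSpace Ω} (hℱ : ℱ ≤ m0)
    {A : Ω → Matrix (Fin m) (Fin n) ℝ} {H : Ω → Matrix (Fin n) (Fin n) ℝ} {ζ κ : ℝ} (hζ : 0 < ζ)
    (hA : ∀ i, StronglyMeasurable[ℱ] fun ω => WithLp.toLp 2 (A ω i))
    (hH : ∀ i j, StronglyMeasurable[ℱ] fun ω => H ω i j)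
    (hHb : ∀ ω z, ‖Matrix.toEuclideanLin (H ω) z‖ ≤ κ * ‖z‖)
    (hpd : ∀ ω z, Matrix.toEuclideanLin (A ω) z = 0 →
      ζ * ‖z‖ ^ 2 ≤ ⟪z, Matrix.toEuclideanLin (H ω) z⟫)
    {w r : Ω → EuclideanSpace ℝ (Fin n)} {y : Ω → EuclideanSpace ℝ (Fin m)}
    (hw : MemLp w 2 μ) (hr : MemLp r 2 μ) (hr0 : μ[r | ℱ] =ᵐ[μ] 0)
    (hAw : ∀ ω, Matrix.toEuclideanLin (A ω) (w ω) = 0)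
    (hsys : ∀ ω, Matrix.toEuclideanLin (H ω) (w ω) + Matrix.toEuclideanLin (A ω)ᵀ (y ω) = r ω) :
    μ[w | ℱ] =ᵐ[μ] 0 := by
  have hwI := hw.integrable one_le_two
  have hrI := hr.integrable one_le_two
  have happly : ∀ ω (z : EuclideanSpace ℝ (Fin n)) i,
      Matrix.toEuclideanLin (A ω) z i = ⟪WithLp.toLp 2 (A ω i), z⟫ := fun ω z i => by
    simp [Matrix.mulVec, dotProduct, PiLp.inner_apply, mul_comm]
  set e := μ[w | ℱ] with he
  have hem : StronglyMeasurable[ℱ] e := stronglyMeasurable_condExp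
  have heL : MemLp e 2 μ := hw.condExp one_le_two
  have hAe : ∀ᵐ ω ∂μ, Matrix.toEuclideanLin (A ω) (e ω) = 0 := by
    have h1 : ∀ i, ∀ᵐ ω ∂μ, ⟪WithLp.toLp 2 (A ω i), e ω⟫ = 0 := fun i => by
      have hz : (fun ω => ⟪WithLp.toLp 2 (A ω i), w ω⟫) = 0 := by
        funext ω
        rw [← happly, hAw]
        rfl
      have h2 := condExp_inner_of_stronglyMeasurable_left (μ := μ) (hA i)
        (by rw [hz]; exact integrable_zero _ _ _) hwI
      rw [hz, condExp_zero] at h2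
      filter_upwards [h2] with ω hω using hω.symm
    filter_upwards [ae_all_iff.2 h1] with ω hω
    ext i
    rw [happly, hω i]
    rfl
  have hHe : StronglyMeasurable[ℱ] fun ω => Matrix.toEuclideanLin (H ω)ᵀ (e ω) :=
    stronglyMeasurable_toEuclideanLin (fun i j => hH j i) hem
  have hHeL : MemLp (fun ω => Matrix.toEuclideanLin (H ω)ᵀ (e ω)) 2 μ :=
    heL.of_le_mul (hHe.mono hℱ).aestronglyMeasurable
      (Filter.Eventually.of_forall fun ω => norm_toEuclideanLin_transpose_le (hHb ω) _)
  have h3 := condExp_inner_of_stronglyMeasurable_left hHe (hHeL.integrable_inner_of_two hw) hwI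
  have h4 := condExp_inner_of_stronglyMeasurable_left hem (heL.integrable_inner_of_two hr) hrI
  have h5 : (fun ω => ⟪Matrix.toEuclideanLin (H ω)ᵀ (e ω), w ω⟫) =ᵐ[μ] fun ω => ⟪e ω, r ω⟫ := by
    filter_upwards [hAe] with ω hω
    rw [← hsys ω, inner_add_right, inner_toEuclideanLin_transpose, hω, inner_zero_left, add_zero,
      real_inner_comm, inner_toEuclideanLin_transpose, real_inner_comm]
  filter_upwards [h3, h4, condExp_congr_ae (m := ℱ) h5, hAe, hr0] with ω k3 k4 k5 k6 k7
  have h6 : ⟪e ω, Matrix.toEuclideanLin (H ω) (e ω)⟫ = 0 := by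
    rw [k3, k4, k7, Pi.zero_apply, inner_zero_right, real_inner_comm,
      inner_toEuclideanLin_transpose] at k5
    rw [real_inner_comm, k5]
  have h7 := hpd ω (e ω) k6
  rw [h6] at h7
  have h8 : ‖e ω‖ ^ 2 ≤ 0 := nonpos_of_mul_nonpos_right h7 hζ
  simpa using h8

/-- Second-moment bound for the solution of a random saddle-point system, split into its
conditional mean `t` and the deviation `w`. -/
lemma integral_norm_sq_saddle_le {m n : ℕ} {ℱ : MeasurableSpace Ω} (hℱ : ℱ ≤ m0)
    {A : Ω → Matrix (Fin m) (Fin n) ℝ} {H : Ω → Matrix (Fin n) (Fin n) ℝ} {ζ κ : ℝ} (hζ : 0 < ζ)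
    (hκ : 0 ≤ κ)
    (hA : ∀ i, StronglyMeasurable[ℱ] fun ω => WithLp.toLp 2 (A ω i))
    (hH : ∀ i j, StronglyMeasurable[ℱ] fun ω => H ω i j)
    (hHb : ∀ ω z, ‖Matrix.toEuclideanLin (H ω) z‖ ≤ κ * ‖z‖)
    (hpd : ∀ ω z, Matrix.toEuclideanLin (A ω) z = 0 →
      ζ * ‖z‖ ^ 2 ≤ ⟪z, Matrix.toEuclideanLin (H ω) z⟫)
    {t w r : Ω → EuclideanSpace ℝ (Fin n)} {y : Ω → EuclideanSpace ℝ (Fin m)} {τ M : ℝ}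
    (ht : StronglyMeasurable[ℱ] t) (htb : ∀ ω, ‖t ω‖ ≤ τ)
    (hAt : ∀ ω, Matrix.toEuclideanLin (A ω) (t ω) = 0)
    (hw : StronglyMeasurable[m0] w) (hr : MemLp r 2 μ) (hr0 : μ[r | ℱ] =ᵐ[μ] 0)
    (hrM : ∫ ω, ‖r ω‖ ^ 2 ∂μ ≤ M)
    (hAw : ∀ ω, Matrix.toEuclideanLin (A ω) (w ω) = 0)
    (hsys : ∀ ω, Matrix.toEuclideanLin (H ω) (w ω) + Matrix.toEuclideanLin (A ω)ᵀ (y ω) = r ω) :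
    Integrable (fun ω => ‖t ω + w ω‖ ^ 2) μ ∧
      ∫ ω, ‖t ω + w ω‖ ^ 2 ∂μ ≤ ζ⁻¹ * (κ * τ ^ 2 + ζ⁻¹ * M) := by
  have hwr : ∀ ω, ‖w ω‖ ≤ ζ⁻¹ * ‖r ω‖ := fun ω => by
    rw [le_inv_mul_iff₀ hζ]
    exact mul_norm_saddle_solution_le (hpd ω _ (hAw ω)) (hAw ω) (hsys ω)
  have hwL : MemLp w 2 μ := hr.of_le_mul hw.aestronglyMeasurable (Filter.Eventually.of_forall hwr)
  have htL : MemLp t 2 μ := .of_bound (ht.mono hℱ).aestronglyMeasurable τ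
    (Filter.Eventually.of_forall htb)
  have hcross : ∫ ω, ⟪t ω, w ω⟫ ∂μ = 0 := by
    have h1 := condExp_inner_of_stronglyMeasurable_left ht (htL.integrable_inner_of_two hwL)
      (hwL.integrable one_le_two)
    rw [← integral_condExp hℱ, integral_congr_ae h1]
    refine integral_eq_zero_of_ae ?_
    filter_upwards [condExp_saddle_solution_eq_zero hℱ hζ hA hH hHb hpd hwL hr hr0 hAw hsys]
      with ω hω
    rw [hω]
    simp
  have htκ : ∀ ω, ‖t ω‖ ^ 2 ≤ ζ⁻¹ * (κ * τ ^ 2) := fun ω => by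
    rw [le_inv_mul_iff₀ hζ]
    have h1 := hpd ω _ (hAt ω)
    have h2 : ⟪t ω, Matrix.toEuclideanLin (H ω) (t ω)⟫ ≤ ‖t ω‖ * (κ * ‖t ω‖) :=
      (real_inner_le_norm _ _).trans (by gcongr; exact hHb _ _)
    have hτ : ‖t ω‖ ^ 2 ≤ τ ^ 2 := pow_le_pow_left₀ (norm_nonneg _) (htb ω) 2
    rcases (norm_nonneg (t ω)).eq_or_lt with h | h
    · rw [← h, zero_pow two_ne_zero, mul_zero]
      positivity
    · have h3 : ζ ≤ κ := le_of_mul_le_mul_right (by nlinarith) (show 0 < ‖t ω‖ ^ 2 by positivity)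
      exact mul_le_mul h3 hτ (sq_nonneg _) (hζ.le.trans h3)
  have hexp : ∀ ω, ‖t ω + w ω‖ ^ 2 = ‖t ω‖ ^ 2 + 2 * ⟪t ω, w ω⟫ + ‖w ω‖ ^ 2 := fun ω =>
    norm_add_sq_real _ _
  have htI : Integrable (fun ω => ‖t ω‖ ^ 2) μ := htL.norm.integrable_sq
  have hwI : Integrable (fun ω => ‖w ω‖ ^ 2) μ := hwL.norm.integrable_sq
  have hcI : Integrable (fun ω => 2 * ⟪t ω, w ω⟫) μ := (htL.integrable_inner_of_two hwL).const_mul 2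
  have htcI : Integrable (fun ω => ‖t ω‖ ^ 2 + 2 * ⟪t ω, w ω⟫) μ := htI.add hcI
  refine ⟨(htL.add hwL).norm.integrable_sq, ?_⟩
  simp only [hexp]
  rw [integral_add htcI hwI, integral_add htI hcI, integral_const_mul, hcross]
  have h1 : ∫ ω, ‖t ω‖ ^ 2 ∂μ ≤ ζ⁻¹ * (κ * τ ^ 2) := by
    simpa using integral_mono htI (integrable_const _) htκ
  have h2 : ∫ ω, ‖w ω‖ ^ 2 ∂μ ≤ ζ⁻¹ ^ 2 * M := by
    calc ∫ ω, ‖w ω‖ ^ 2 ∂μ ≤ ∫ ω, ζ⁻¹ ^ 2 * ‖r ω‖ ^ 2 ∂μ :=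
          integral_mono hwI (hr.norm.integrable_sq.const_mul _) fun ω => by
            simpa [mul_pow] using pow_le_pow_left₀ (norm_nonneg _) (hwr ω) 2
      _ ≤ _ := by rw [integral_const_mul]; gcongr
  linarith

/-- A square-integrable deviation from a bounded conditional mean: it is in `L²`, it has zero
conditional expectation, and its second moment inherits the conditional bound. -/
lemma sub_condMean_properties {E : Type*} [NormedAddCommGroup E] [InnerProductSpace ℝ E]
    [CompleteSpace E] {ℱ : MeasurableSpace Ω} (hℱ : ℱ ≤ m0) {X Y : Ω → E} {κ M : ℝ}
    (hX : StronglyMeasurable[ℱ] X) (hXb : ∀ ω, ‖X ω‖ ≤ κ) (hY : StronglyMeasurable[m0] Y)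
    (hmean : μ[Y | ℱ] =ᵐ[μ] X) (hint : Integrable (fun ω => ‖Y ω - X ω‖ ^ 2) μ)
    (hvar : ∀ᵐ ω ∂μ, (μ[fun ω => ‖Y ω - X ω‖ ^ 2 | ℱ]) ω ≤ M) :
    MemLp (X - Y) 2 μ ∧ μ[X - Y | ℱ] =ᵐ[μ] 0 ∧ ∫ ω, ‖(X - Y) ω‖ ^ 2 ∂μ ≤ M := by
  have hXI : Integrable X μ := .of_bound (hX.mono hℱ).aestronglyMeasurable κ
    (Filter.Eventually.of_forall hXb)
  have hL : MemLp (X - Y) 2 μ := by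
    refine (memLp_two_iff_integrable_sq_norm ((hX.mono hℱ).sub hY).aestronglyMeasurable).2 ?_
    simpa only [Pi.sub_apply, norm_sub_rev] using hint
  have hYI : Integrable Y μ := by
    simpa using hXI.sub (hL.integrable one_le_two)
  refine ⟨hL, ?_, ?_⟩
  · filter_upwards [condExp_sub hXI hYI ℱ, hmean] with ω h1 h2
    rw [h1, Pi.sub_apply, h2, condExp_of_stronglyMeasurable hℱ hX hXI, sub_self, Pi.zero_apply]
  · simp only [Pi.sub_apply, norm_sub_rev (X _)]
    rw [← integral_condExp hℱ]
    simpa using integral_mono_ae integrable_condExp (integrable_const M) hvar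

/-- Expected form of the pathwise progress estimate, by Jensen's inequality for the logarithm. -/
lemma expected_progress_le {X S U : Ω → ℝ} {ξ D P W a b : ℝ} (hD : 0 ≤ D)
    (hX : Integrable X μ) (hS : Integrable S μ) (hU : Integrable U μ) (hX1 : ∀ ω, 1 ≤ X ω)
    (hprog : ∀ ω, ξ * S ω ≤ P + D * Real.log (X ω ^ 2) + W * U ω)
    (hgrow : ∀ ω, X ω ≤ a + b * S ω) :
    1 ≤ ∫ ω, X ω ∂μ ∧ ∫ ω, X ω ∂μ ≤ a + b * ∫ ω, S ω ∂μ ∧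
      ξ * ∫ ω, S ω ∂μ ≤ P + 2 * D * Real.log (∫ ω, X ω ∂μ) + W * ∫ ω, U ω ∂μ := by
  have hE1 : 1 ≤ ∫ ω, X ω ∂μ := by
    simpa using integral_mono (integrable_const (1 : ℝ)) hX hX1
  set E : ℝ := ∫ ω, X ω ∂μ with hE
  have hE0 : 0 < E := one_pos.trans_le hE1
  refine ⟨hE1, ?_, ?_⟩
  · have h := integral_mono (g := fun ω => a + b * S ω) hX
      ((integrable_const a).add (hS.const_mul b)) hgrow
    rw [integral_add (integrable_const _) (hS.const_mul _), integral_const_mul] at h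
    simpa using h
  · have hlog : ∀ ω, Real.log (X ω ^ 2) ≤ 2 * (Real.log E + (X ω / E - 1)) := fun ω => by
      have hXpos := one_pos.trans_le (hX1 ω)
      have h := Real.log_le_sub_one_of_pos (x := X ω / E) (by positivity)
      rw [Real.log_div hXpos.ne' hE0.ne'] at h
      rw [Real.log_pow]
      push_cast
      linarith
    have hXI : Integrable (fun ω => 2 * D * (1 / E) * X ω) μ := hX.const_mul _
    have hUI : Integrable (fun ω => W * U ω) μ := hU.const_mul _
    set T : ℝ := P + 2 * D * Real.log E - 2 * D with hT
    have hTX : Integrable (fun ω => T + 2 * D * (1 / E) * X ω) μ := (integrable_const T).add hXI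
    have h := integral_mono (g := fun ω => T + 2 * D * (1 / E) * X ω + W * U ω)
      (hS.const_mul ξ) (hTX.add hUI) fun ω => by
        have h1 := mul_le_mul_of_nonneg_left (hlog ω) hD
        have h2 : D * (2 * (Real.log E + (X ω / E - 1)))
            = 2 * D * Real.log E - 2 * D + 2 * D * (1 / E) * X ω := by field_simp; ring
        linarith [hprog ω]
    rw [integral_add hTX hUI, integral_add (integrable_const _) hXI, integral_const_mul,
      integral_const_mul, integral_const_mul, ← hE] at h
    have h3 : 2 * D * (1 / E) * E = 2 * D := by field_simp
    simp only [integral_const, probReal_univ, one_smul, h3] at h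
    linarith

end Stochastic

/-- Constraint-violation bounds for the two-stepsize stochastic SQP
method with safeguarded backtracking line search (fixed horizon `K`, `β_k = η/√K`). -/
theorem stmt19 {m n : ℕ} (hm : 1 ≤ m) (hmn : m ≤ n)
    {Ω : Type*} {m0 : MeasurableSpace Ω} (μ : Measure Ω) [IsProbabilityMeasure μ]
    (ℱ : Filtration ℕ m0)
    -- problem data
    (f : EuclideanSpace ℝ (Fin n) → ℝ)
    (gradf : EuclideanSpace ℝ (Fin n) → EuclideanSpace ℝ (Fin n))
    (c : EuclideanSpace ℝ (Fin n) → EuclideanSpace ℝ (Fin m))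
    (gradc : Fin m → EuclideanSpace ℝ (Fin n) → EuclideanSpace ℝ (Fin n))
    (flow L κg κc s ζ κH M η ν θ σ ξ qm1 : ℝ) (γ : Fin m → ℝ)
    (hL : 0 < L) (hκg : 0 < κg) (hκc : 0 < κc) (hs : 0 < s) (hζ : 0 < ζ)
    (hκH : 0 < κH) (hM : 0 < M) (hη : 0 < η) (hν : 0 < ν) (hθ : 0 < θ)
    (hξ : ξ ∈ Set.Ioo (0 : ℝ) 1) (hqm1 : 1 ≤ qm1)
    (hσ : σ ∈ Set.Ioo (0 : ℝ) 1) (hγ : ∀ i, 0 < γ i)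
    (hf : ∀ z, HasGradientAt f (gradf z) z)
    (hflow : ∀ z, flow ≤ f z)
    (hfLip : ∀ z z', ‖gradf z - gradf z'‖ ≤ L * ‖z - z'‖)
    (hgradb : ∀ z, ‖gradf z‖ ≤ κg)
    (hc : ∀ i z, HasGradientAt (fun w => c w i) (gradc i z) z)
    (hcb : ∀ z, l1Norm (c z) ≤ κc)
    (hcLip : ∀ i z z', ‖gradc i z - gradc i z'‖ ≤ γ i * ‖z - z'‖)
    -- algorithm iterates
    (x0 : EuclideanSpace ℝ (Fin n))
    (x u utrue g v : ℕ → Ω → EuclideanSpace ℝ (Fin n))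
    (y ytrue : ℕ → Ω → EuclideanSpace ℝ (Fin m))
    (H : ℕ → Ω → Matrix (Fin n) (Fin n) ℝ)
    (α : ℕ → Ω → ℝ) (q : ℕ → Ω → ℝ)
    (hx0 : ∀ ω, x 0 ω = x0)
    (hxmeas : ∀ k, StronglyMeasurable[ℱ k] (x k))
    (hHmeas : ∀ k i j, StronglyMeasurable[ℱ k] (fun ω => H k ω i j))
    (hHnorm : ∀ k ω (z : EuclideanSpace ℝ (Fin n)),
      ‖Matrix.toEuclideanLin (H k ω) z‖ ≤ κH * ‖z‖)
    (hHpd : ∀ k ω (z : EuclideanSpace ℝ (Fin n)),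
      Matrix.toEuclideanLin (Jmat gradc (x k ω)) z = 0 →
      ζ * ‖z‖ ^ 2 ≤ ⟪z, Matrix.toEuclideanLin (H k ω) z⟫)
    (hsv : ∀ k ω (z : EuclideanSpace ℝ (Fin m)),
      s * ‖z‖ ≤ ‖Matrix.toEuclideanLin (Jmat gradc (x k ω))ᵀ z‖)
    (hgmeas : ∀ k, StronglyMeasurable[ℱ (k + 1)] (g k))
    (hgmean : ∀ k, μ[g k | ℱ k] =ᵐ[μ] fun ω => gradf (x k ω))
    (hgvarint : ∀ k, Integrable (fun ω => ‖g k ω - gradf (x k ω)‖ ^ 2) μ)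
    (hgvar : ∀ k, ∀ᵐ ω ∂μ,
      (μ[fun ω' => ‖g k ω' - gradf (x k ω')‖ ^ 2 | ℱ k]) ω ≤ M)
    (humeas : ∀ k, StronglyMeasurable[ℱ (k + 1)] (u k))
    (hymeas : ∀ k, StronglyMeasurable[ℱ (k + 1)] (y k))
    (hvmeas : ∀ k, StronglyMeasurable[ℱ k] (v k))
    (hutmeas : ∀ k, StronglyMeasurable[ℱ k] (utrue k))
    (hytmeas : ∀ k, StronglyMeasurable[ℱ k] (ytrue k))
    (hJu : ∀ k ω, Matrix.toEuclideanLin (Jmat gradc (x k ω)) (u k ω) = 0)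
    (hvrange : ∀ k ω, ∃ z : EuclideanSpace ℝ (Fin m),
      v k ω = Matrix.toEuclideanLin (Jmat gradc (x k ω))ᵀ z)
    (hJp : ∀ k ω, Matrix.toEuclideanLin (Jmat gradc (x k ω)) (u k ω + v k ω)
      = -(c (x k ω)))
    (hsys : ∀ k ω, Matrix.toEuclideanLin (H k ω) (u k ω + v k ω)
      + Matrix.toEuclideanLin (Jmat gradc (x k ω))ᵀ (y k ω) = -(g k ω))
    (hJut : ∀ k ω, Matrix.toEuclideanLin (Jmat gradc (x k ω)) (utrue k ω) = 0)
    (hsyst : ∀ k ω, Matrix.toEuclideanLin (H k ω) (utrue k ω + v k ω)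
      + Matrix.toEuclideanLin (Jmat gradc (x k ω))ᵀ (ytrue k ω) = -(gradf (x k ω)))
    -- fixed horizon and stepsizes
    (K : ℕ) (hK : 1 ≤ K)
    -- safeguarded backtracking line search
    (hqmeas : ∀ k, StronglyMeasurable[ℱ (k + 1)] (q k))
    (hαmeas : ∀ k, StronglyMeasurable[ℱ (k + 1)] (α k))
    (hcase : ∀ k ω,
      (α k ω ∈ Set.Icc
          (ν / Real.sqrt ((prevSeq qm1 q k ω) ^ 2 + l1Norm (c (x k ω))))
          (ν / Real.sqrt ((prevSeq qm1 q k ω) ^ 2 + l1Norm (c (x k ω)))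
            + θ * (η / Real.sqrt K)) ∧
        l1Norm (c (x k ω + α k ω • ((η / Real.sqrt K) • u k ω + v k ω)))
          ≤ (1 - ξ * α k ω) * l1Norm (c (x k ω)) ∧
        q k ω = prevSeq qm1 q k ω) ∨
      (α k ω = ν / Real.sqrt ((prevSeq qm1 q k ω) ^ 2 + l1Norm (c (x k ω))) ∧
        q k ω = Real.sqrt ((prevSeq qm1 q k ω) ^ 2 + l1Norm (c (x k ω)))))
    (hupdate : ∀ k ω, x (k + 1) ω
      = x k ω + α k ω • ((η / Real.sqrt K) • u k ω + v k ω))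
    -- constants
    (κv κu Γ κ₃ κ₉ κ₁₀ : ℝ)
    (hκv : κv = max (1 / s) (κc / s ^ 2))
    (hκu : κu = ζ⁻¹ * κg + ζ⁻¹ * κH * κv * κc)
    (hΓ : Γ = ∑ i, γ i)
    (hκ₃ : κ₃ = ζ⁻¹ * (κH * κu ^ 2 + ζ⁻¹ * M))
    (hκ₉ : κ₉ = ξ⁻¹ * (l1Norm (c x0) - (2 + Γ * κv / 2) * ν ^ 2 * Real.log (qm1 ^ 2)
      + ν ^ 2 * η ^ 2 * Γ * κ₃ / (2 * qm1 ^ 2)))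
    (hκ₁₀ : κ₁₀ = 2 * (qm1 + κ₉ / ν)
      + 8 * (4 + Γ * κv) * ξ⁻¹ * ν * Real.log (Real.exp 1 + (4 + Γ * κv) * ξ⁻¹ * ν)) :
    (∫ ω, q (K - 1) ω ∂μ ≤ κ₁₀) ∧
    (∑ k ∈ Finset.range K, ∫ ω, α k ω * l1Norm (c (x k ω)) ∂μ
      ≤ κ₉ + (4 + Γ * κv) * ξ⁻¹ * ν ^ 2 * Real.log κ₁₀) := by
  obtain ⟨hξ0, hξ1⟩ := hξ
  have hq0 : 0 < qm1 := one_pos.trans_le hqm1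
  have hKpos : (0 : ℝ) < K := by exact_mod_cast hK
  have hΓ0 : 0 < Γ := by
    rw [hΓ]
    exact Finset.sum_pos (fun i _ => hγ i) ⟨⟨0, hm⟩, Finset.mem_univ _⟩
  have hκv0 : 0 < κv := by rw [hκv]; exact lt_max_of_lt_left (by positivity)
  have hcx : ∀ k ω, l1Norm (c (x k ω)) ≤ κc := fun k ω => hcb _
  have hJv : ∀ k ω, Matrix.toEuclideanLin (Jmat gradc (x k ω)) (v k ω) = -c (x k ω) :=
    fun k ω => by
      have h := hJp k ω
      rwa [map_add, hJu, zero_add] at h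
  have hvs : ∀ k ω, ‖v k ω‖ ≤ 1 / s * l1Norm (c (x k ω)) := fun k ω => by
    rw [one_div, le_inv_mul_iff₀ hs]
    exact (mul_norm_normal_step_le (hsv k ω) hs.le (hvrange k ω) (hJv k ω)).trans
      (norm_le_l1Norm _)
  have hv2 : ∀ k ω, ‖v k ω‖ ^ 2 ≤ κv * l1Norm (c (x k ω)) := fun k ω => by
    have hC := l1Norm_nonneg (c (x k ω))
    calc ‖v k ω‖ ^ 2 ≤ (1 / s * l1Norm (c (x k ω))) ^ 2 :=
          pow_le_pow_left₀ (norm_nonneg _) (hvs k ω) 2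
      _ = l1Norm (c (x k ω)) / s ^ 2 * l1Norm (c (x k ω)) := by field_simp
      _ ≤ κc / s ^ 2 * l1Norm (c (x k ω)) := by gcongr; exact hcx k ω
      _ ≤ κv * l1Norm (c (x k ω)) := by gcongr; rw [hκv]; exact le_max_right _ _
  have hut : ∀ k ω, ‖utrue k ω‖ ≤ κu := fun k ω => by
    have hvb : ‖v k ω‖ ≤ κv * κc :=
      (hvs k ω).trans (mul_le_mul (by rw [hκv]; exact le_max_left _ _) (hcx k ω)
        (l1Norm_nonneg _) hκv0.le)
    have h1 : Matrix.toEuclideanLin (H k ω) (utrue k ω)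
        + Matrix.toEuclideanLin (Jmat gradc (x k ω))ᵀ (ytrue k ω)
        = -gradf (x k ω) - Matrix.toEuclideanLin (H k ω) (v k ω) := by
      rw [← hsyst k ω, map_add]
      abel
    have h2 := mul_norm_saddle_solution_le (hHpd k ω _ (hJut k ω)) (hJut k ω) h1
    have h3 : ‖-gradf (x k ω) - Matrix.toEuclideanLin (H k ω) (v k ω)‖
        ≤ κg + κH * (κv * κc) := by
      refine (norm_sub_le _ _).trans (add_le_add ?_ ((hHnorm k ω _).trans (by gcongr)))
      rw [norm_neg]
      exact hgradb _
    calc ‖utrue k ω‖ ≤ ζ⁻¹ * (κg + κH * (κv * κc)) := by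
          rw [le_inv_mul_iff₀ hζ]; exact h2.trans h3
      _ = κu := by rw [hκu]; ring
  have hgradf_cont : Continuous gradf :=
    (LipschitzWith.of_dist_le_mul (K := L.toNNReal) fun z z' => by
      simpa [dist_eq_norm, Real.coe_toNNReal L hL.le] using hfLip z z').continuous
  have hgradc_cont : ∀ i, Continuous (gradc i) := fun i =>
    (LipschitzWith.of_dist_le_mul (K := (γ i).toNNReal) fun z z' => by
      simpa [dist_eq_norm, Real.coe_toNNReal _ (hγ i).le] using hcLip i z z').continuous
  have hc_cont : Continuous c := by
    refine (PiLp.continuous_toLp 2 _).comp (continuous_pi fun i => ?_)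
    exact continuous_iff_continuousAt.2 fun z => (hc i z).continuousAt
  have hu2 : ∀ k, Integrable (fun ω => ‖u k ω‖ ^ 2) μ ∧ ∫ ω, ‖u k ω‖ ^ 2 ∂μ ≤ κ₃ := fun k => by
    obtain ⟨hrL, hr0, hrM⟩ := sub_condMean_properties (ℱ.le k)
      (hgradf_cont.comp_stronglyMeasurable (hxmeas k)) (fun ω => hgradb _)
      ((hgmeas k).mono (ℱ.le _)) (hgmean k) (hgvarint k) (hgvar k)
    have h := integral_norm_sq_saddle_le (μ := μ) (ℱ.le k) (A := fun ω => Jmat gradc (x k ω))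
      (H := H k) hζ hκH.le (fun i => (hgradc_cont i).comp_stronglyMeasurable (hxmeas k))
      (hHmeas k) (hHnorm k) (hHpd k) (w := fun ω => u k ω - utrue k ω)
      (y := fun ω => y k ω - ytrue k ω) (hutmeas k) (hut k) (hJut k)
      (((humeas k).mono (ℱ.le _)).sub ((hutmeas k).mono (ℱ.le _))) hrL hr0 hrM
      (fun ω => by rw [map_sub, hJu, hJut, sub_zero])
      (fun ω => by
        have h1 := hsys k ω
        have h2 := hsyst k ω
        simp only [map_add, map_sub, Pi.sub_apply] at h1 h2 ⊢
        rw [← neg_eq_iff_eq_neg.2 h1, ← neg_eq_iff_eq_neg.2 h2]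
        abel)
    simpa [hκ₃] using h
  set β := η / √(K : ℝ) with hβ
  have hβ0 : 0 < β := by positivity
  have hβ2 : β ^ 2 = η ^ 2 / K := by rw [hβ, div_pow, Real.sq_sqrt hKpos.le]
  have hpath : ∀ ω, _ := fun ω => safeguarded_sum (Q := fun k => prevSeq qm1 q k ω)
    (C := fun k => l1Norm (c (x k ω))) (a := fun k => α k ω) (U := fun k => ‖u k ω‖ ^ 2)
    (G := Γ) (κ := κv) (b := β ^ 2) hν ⟨hξ0, hξ1⟩ hΓ0.le hκv0.le (sq_nonneg _) hq0
    (fun k => l1Norm_nonneg _) (fun k => sq_nonneg _)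
    (fun k => by
      rcases hcase k ω with ⟨h1, h2, h3⟩ | ⟨h1, h2⟩
      · exact Or.inl ⟨h1.1, by rw [hupdate]; exact h2, h3⟩
      · refine Or.inr ⟨h1, h2, ?_⟩
        have hd : Matrix.toEuclideanLin (Jmat gradc (x k ω)) (β • u k ω + v k ω)
            = -c (x k ω) := by
          rw [map_add, map_smul, hJu, smul_zero, zero_add, hJv]
        have horth : ⟪β • u k ω, v k ω⟫ = 0 := by
          obtain ⟨z, hz⟩ := hvrange k ω
          rw [hz, inner_smul_left, inner_toEuclideanLin_transpose, hJu, inner_zero_left, mul_zero]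
        have hnorm : ‖β • u k ω + v k ω‖ ^ 2
            ≤ β ^ 2 * ‖u k ω‖ ^ 2 + κv * l1Norm (c (x k ω)) := by
          rw [norm_add_sq_real, horth, norm_smul, mul_pow, Real.norm_eq_abs, sq_abs]
          linarith [hv2 k ω]
        have hstep := l1Norm_constraint_step_le hc hcLip hd (α k ω)
        rw [← hΓ] at hstep
        rw [hupdate]
        exact hstep.trans (by gcongr))
  have hQge : ∀ k ω, qm1 ≤ prevSeq qm1 q k ω := fun k ω => (hpath ω k).2.1
  have hQmeas : ∀ k, StronglyMeasurable[m0] (prevSeq qm1 q k) := fun k => by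
    cases k with
    | zero => exact stronglyMeasurable_const
    | succ k => exact (hqmeas k).mono (ℱ.le _)
  have hCmeas : ∀ k, StronglyMeasurable[m0] fun ω => l1Norm (c (x k ω)) := fun k =>
    (continuous_l1Norm.comp hc_cont).comp_stronglyMeasurable ((hxmeas k).mono (ℱ.le _))
  have hαb : ∀ k ω, |α k ω| ≤ ν / qm1 + θ * β := fun k ω => by
    have hR : qm1 ≤ √(prevSeq qm1 q k ω ^ 2 + l1Norm (c (x k ω))) :=
      Real.le_sqrt_of_sq_le (by
        nlinarith [hQge k ω, l1Norm_nonneg (c (x k ω))])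
    have h0 : 0 ≤ ν / √(prevSeq qm1 q k ω ^ 2 + l1Norm (c (x k ω))) := by positivity
    have h1 : ν / √(prevSeq qm1 q k ω ^ 2 + l1Norm (c (x k ω))) ≤ ν / qm1 := by gcongr
    have h2 : 0 ≤ θ * β := by positivity
    rcases hcase k ω with ⟨h3, -⟩ | ⟨h3, -⟩
    · rw [abs_of_nonneg (h0.trans h3.1)]
      exact h3.2.trans (by gcongr)
    · rw [h3, abs_of_nonneg h0]
      linarith
  have hαC : ∀ k, Integrable (fun ω => α k ω * l1Norm (c (x k ω))) μ := fun k =>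
    .of_bound (((hαmeas k).mono (ℱ.le _)).mul (hCmeas k)).aestronglyMeasurable
      ((ν / qm1 + θ * β) * κc) (Filter.Eventually.of_forall fun ω => by
        rw [norm_mul, Real.norm_eq_abs, Real.norm_of_nonneg (l1Norm_nonneg _)]
        exact mul_le_mul (hαb k ω) (hcx k ω) (l1Norm_nonneg _) (by positivity))
  set X : Ω → ℝ := prevSeq qm1 q K with hX
  have hqX : q (K - 1) = X := by
    obtain ⟨j, rfl⟩ := Nat.exists_eq_add_of_le' hK
    rfl
  have hX1 : ∀ ω, 1 ≤ X ω := fun ω => hqm1.trans (hQge K ω)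
  have hXI : Integrable X μ := .of_bound (hQmeas K).aestronglyMeasurable (qm1 ^ 2 + K * κc)
    (Filter.Eventually.of_forall fun ω => by
      rw [Real.norm_of_nonneg (zero_le_one.trans (hX1 ω))]
      have h1 : X ω ^ 2 ≤ qm1 ^ 2 + ∑ k ∈ Finset.range K, l1Norm (c (x k ω)) := (hpath ω K).2.2.2
      have h2 : ∑ k ∈ Finset.range K, l1Norm (c (x k ω)) ≤ K * κc := by
        simpa using Finset.sum_le_sum (s := Finset.range K) fun k _ => hcx k ω
      nlinarith [hX1 ω])
  set S : ℝ := ∑ k ∈ Finset.range K, ∫ ω, α k ω * l1Norm (c (x k ω)) ∂μ with hS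
  have hSint : ∫ ω, ∑ k ∈ Finset.range K, α k ω * l1Norm (c (x k ω)) ∂μ = S :=
    integral_finsetSum _ fun k _ => hαC k
  have hSI : Integrable (fun ω => ∑ k ∈ Finset.range K, α k ω * l1Norm (c (x k ω))) μ :=
    integrable_finsetSum _ fun k _ => hαC k
  have hUI : Integrable (fun ω => ∑ k ∈ Finset.range K, ‖u k ω‖ ^ 2) μ :=
    integrable_finsetSum _ fun k _ => (hu2 k).1
  have hU : ∫ ω, ∑ k ∈ Finset.range K, ‖u k ω‖ ^ 2 ∂μ ≤ K * κ₃ := by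
    rw [integral_finsetSum _ fun k _ => (hu2 k).1]
    simpa using Finset.sum_le_sum (s := Finset.range K) fun k _ => (hu2 k).2
  obtain ⟨hE1, hES, hξS⟩ := expected_progress_le (μ := μ) (ξ := ξ)
    (D := (2 + Γ * κv / 2) * ν ^ 2)
    (P := l1Norm (c x0) - (2 + Γ * κv / 2) * ν ^ 2 * Real.log (qm1 ^ 2))
    (W := ν ^ 2 * Γ / (2 * qm1 ^ 2) * β ^ 2) (a := qm1) (b := ν⁻¹) (by positivity)
    hXI hSI hUI hX1
    (fun ω => by
      have h0 : prevSeq qm1 q 0 ω = qm1 := rfl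
      have h1 := (hpath ω K).1
      have h2 := l1Norm_nonneg (c (x K ω))
      simp only [hx0 ω, h0, ← hX] at h1
      linarith)
    (fun ω => (hpath ω K).2.2.1)
  rw [hSint] at hES hξS
  set E : ℝ := ∫ ω, X ω ∂μ
  have hE0 : 0 < E := one_pos.trans_le hE1
  set B : ℝ := (4 + Γ * κv) * ξ⁻¹ * ν with hB
  have hB0 : 0 < B := by positivity
  have hSE : S ≤ κ₉ + B * ν * Real.log E := by
    have h1 : ν ^ 2 * Γ / (2 * qm1 ^ 2) * β ^ 2 * ∫ ω, ∑ k ∈ Finset.range K, ‖u k ω‖ ^ 2 ∂μ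
        ≤ ν ^ 2 * Γ / (2 * qm1 ^ 2) * (η ^ 2 * κ₃) := by
      calc _ ≤ ν ^ 2 * Γ / (2 * qm1 ^ 2) * β ^ 2 * (K * κ₃) := by gcongr
        _ = _ := by rw [hβ2]; field_simp
    refine le_of_mul_le_mul_left ((hξS.trans (add_le_add_right h1 _)).trans_eq ?_) hξ0
    rw [hκ₉, hB]
    field_simp
    ring
  have hEκ : E ≤ κ₁₀ := by
    have h1 : E ≤ (qm1 + κ₉ / ν) + B * Real.log E := by
      calc E ≤ qm1 + ν⁻¹ * S := hES
        _ ≤ qm1 + ν⁻¹ * (κ₉ + B * ν * Real.log E) := by gcongr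
        _ = _ := by field_simp; ring
    refine (le_of_le_add_mul_log hE0 hB0 h1).trans_eq ?_
    rw [hκ₁₀, hB]
    ring
  refine ⟨by rw [hqX]; exact hEκ, hSE.trans ?_⟩
  have h1 : B * ν = (4 + Γ * κv) * ξ⁻¹ * ν ^ 2 := by rw [hB]; ring
  rw [h1]
  gcongr
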